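/- Let (W, S) be a Coxeter system, (Q, φ) a maximal partial special matching with a = φ(e), s ∈ S with s ≠ a, and w ∈ Q. If φ(sv) = s·φ(v) for every v ≤ w with v ∈ P_s = ⟨s, a⟩, then sw ∈ Q and φ(sw) = s·φ(w). -/

import Mathlib

open CoxeterSystem Polynomial

section CoxPre

variable {B : Type*} {W : Type*} [Group W] {M : CoxeterMatrix B}

/-- The alternating word of length `n` starting with the letter `i`
(and then alternating between `i` and `j`). -/
def altW (i j : B) : ℕ → List B
  | 0 => []
  | n + 1 => i :: altW j i n

variable (cs : CoxeterSystem M W)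

/-- The Bruhat order on a Coxeter group: the reflexive-transitive closure of the
relation `u → u * t` (`t` a reflection) when the length goes up. -/
def bruhatLE : W → W → Prop :=
  Relation.ReflTransGen
    (fun u v => ∃ t, cs.IsReflection t ∧ v = u * t ∧ cs.length u < cs.length v)

/-- The covering relation of the Bruhat order. -/
def bCov (u v : W) : Prop :=
  bruhatLE cs u v ∧ u ≠ v ∧ ∀ z, bruhatLE cs u z → bruhatLE cs z v → z = u ∨ z = v

/-- The set of coatoms of `v` in the Bruhat order. -/
def bCoat (v : W) : Set W := {x | bCov cs x v}

/-- A partial special matching of `W` equipped with the Bruhat order: a Bruhat order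
ideal `dom` together with an involution of it such that `u ⋖ φ u` or `φ u ⋖ u` for all
`u ∈ dom`, satisfying the coatom condition. -/
structure BSM where
  dom : Set W
  toFun : W → W
  ideal : ∀ ⦃x y : W⦄, y ∈ dom → bruhatLE cs x y → x ∈ dom
  maps : ∀ x ∈ dom, toFun x ∈ dom
  invol : ∀ x ∈ dom, toFun (toFun x) = x
  cov : ∀ x ∈ dom, bCov cs (toFun x) x ∨ bCov cs x (toFun x)
  coatom : ∀ u ∈ dom, bCov cs u (toFun u) →
    bCoat cs (toFun u) =
      {u} ∪ {w | ∃ v, bCov cs v u ∧ bCov cs v (toFun v) ∧ w = toFun v}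

/-- The standard dihedral subgroup `⟨s,t⟩` of `W`, as a set. -/
def dihedral (s t : B) : Set W :=
  (Subgroup.closure {cs.simple s, cs.simple t} : Subgroup W)

/-- `w` is full with respect to `J ⊆ S`: for all distinct `i, j ∈ J`, `m i j < ∞` and the
longest element of `⟨i,j⟩` is `≤ w` in Bruhat order. -/
def IsFullWrt (J : Set B) (w : W) : Prop :=
  ∀ i ∈ J, ∀ j ∈ J, i ≠ j →
    M i j ≠ 0 ∧ bruhatLE cs (cs.wordProd (altW i j (M i j))) w

/-- The standard axioms characterizing the `R`-polynomials of the Hecke algebra of `W`. -/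
def RAxioms (R : W → W → Polynomial ℤ) : Prop :=
  (∀ u, R u u = 1) ∧
  (∀ u v, ¬ bruhatLE cs u v → R u v = 0) ∧
  (∀ (i : B) (x y : W),
      cs.length (cs.simple i * x) = cs.length x + 1 →
      cs.length (cs.simple i * y) = cs.length y + 1 →
      R (cs.simple i * x) (cs.simple i * y) = R x y ∧
      R x (cs.simple i * y) = (X - 1) * R x y + X * R (cs.simple i * x) y) ∧
  (∀ (i : B) (x y : W),
      cs.length (x * cs.simple i) = cs.length x + 1 →
      cs.length (y * cs.simple i) = cs.length y + 1 →
      R (x * cs.simple i) (y * cs.simple i) = R x y ∧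
      R x (y * cs.simple i) = (X - 1) * R x y + X * R (x * cs.simple i) y)

variable {cs}

/-- `ψ` extends the partial special matching `φ`. -/
def BExtends (ψ φ : BSM cs) : Prop :=
  φ.dom ⊆ ψ.dom ∧ ∀ x ∈ φ.dom, ψ.toFun x = φ.toFun x

/-- `φ` is a maximal partial special matching. -/
def BMax (φ : BSM cs) : Prop := ∀ ψ : BSM cs, BExtends ψ φ → ψ.dom = φ.dom

/-- `φ` is `g`-regular on the left: its domain is stable under left multiplication by `g`
and `φ` commutes with left multiplication by `g`. -/
def LeftReg (φ : BSM cs) (g : W) : Prop :=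
  (∀ x ∈ φ.dom, g * x ∈ φ.dom) ∧ ∀ x ∈ φ.dom, φ.toFun (g * x) = g * φ.toFun x

/-- `φ` is `g`-regular on the right. -/
def RightReg (φ : BSM cs) (g : W) : Prop :=
  (∀ x ∈ φ.dom, x * g ∈ φ.dom) ∧ ∀ x ∈ φ.dom, φ.toFun (x * g) = φ.toFun x * g

end CoxPre

/-- The product of two reflections meeting at the angle `π / m` has order dividing `m`. -/
theorem reflection_mul_reflection_pow_eq_one {V : Type*} [AddCommGroup V] [Module ℝ V]
    {x y : V} {f g : Module.Dual ℝ V} (hf : f x = 2) (hg : g y = 2) {m : ℕ} (hm : 2 ≤ m)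
    (hfy : f y = -2 * Real.cos (Real.pi / m)) (hgx : g x = -2 * Real.cos (Real.pi / m)) :
    (Module.reflection hf * Module.reflection hg) ^ m = 1 := by
  have hm0 : (m : ℝ) ≠ 0 := by positivity
  have ht : 2 * Real.cos (2 * (Real.pi / m)) = f y * g x - 2 := by
    rw [hfy, hgx, Real.cos_two_mul]; ring
  ext z
  rw [Module.reflection_mul_reflection_pow_apply hf hg m z _ ht]
  rcases hm.eq_or_lt with rfl | hm
  · have hy : f y = 0 := by simp [hfy]
    have hx : g x = 0 := by simp [hgx]
    have ht' : 2 * Real.cos (2 * (Real.pi / (2 : ℕ))) = -2 := by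
      rw [ht, hy, hx]; norm_num
    rw [ht']
    norm_num [hy, hx]
    abel
  · have hs : Real.sin (2 * (Real.pi / m)) ≠ 0 := by
      refine (Real.sin_pos_of_pos_of_lt_pi (by positivity) ?_).ne'
      rw [mul_div_assoc', div_lt_iff₀ (by positivity), mul_comm]
      have : (2 : ℝ) < m := by exact_mod_cast hm
      exact mul_lt_mul_of_pos_left this Real.pi_pos
    have hS : ∀ n : ℤ, (Polynomial.Chebyshev.S ℝ n).eval (2 * Real.cos (2 * (Real.pi / m))) =
        Real.sin ((n + 1) * (2 * (Real.pi / m))) / Real.sin (2 * (Real.pi / m)) := fun n => by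
      rw [eq_div_iff hs]; exact Polynomial.Chebyshev.S_two_mul_real_cos _ _
    rcases Nat.even_or_odd' m with ⟨k, hk | hk⟩
    · have e1 : ((m : ℤ) - 2) / 2 = k - 1 := by omega
      have e2 : ((m : ℤ) - 1) / 2 = k - 1 := by omega
      have h0 : (Polynomial.Chebyshev.S ℝ (k - 1)).eval
          (2 * Real.cos (2 * (Real.pi / m))) = 0 := by
        rw [hS]
        have : (((k - 1 : ℤ) : ℝ) + 1) * (2 * (Real.pi / m)) = Real.pi := by
          push_cast
          field_simp
          rw [hk]; push_cast; ring
        rw [this]; simp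
      rw [e1, e2, h0]; simp
    · have e1 : ((m : ℤ) - 2) / 2 = k - 1 := by omega
      have e2 : ((m : ℤ) - 1) / 2 = k := by omega
      have e3 : ((m : ℤ) - 3) / 2 = k - 1 := by omega
      have e4 : (m : ℤ) / 2 = k := by omega
      have h0 : (Polynomial.Chebyshev.S ℝ k).eval (2 * Real.cos (2 * (Real.pi / m))) +
          (Polynomial.Chebyshev.S ℝ (k - 1)).eval (2 * Real.cos (2 * (Real.pi / m))) = 0 := by
        rw [hS, hS, ← add_div]
        have : (((k : ℤ) : ℝ) + 1) * (2 * (Real.pi / m)) =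
            2 * Real.pi - (((k - 1 : ℤ) : ℝ) + 1) * (2 * (Real.pi / m)) := by
          push_cast
          field_simp
          rw [hk]; push_cast; ring
        rw [this, Real.sin_two_pi_sub]; simp
      rw [e1, e2, e3, e4, h0]; simp

namespace CoxeterSystem

variable {B : Type*} {W : Type*} [Group W] {M : CoxeterMatrix B} (cs : CoxeterSystem M W)

/-- The simple reflections are distinct, as seen in the geometric representation. -/
theorem simple_injective : Function.Injective cs.simple := by
  classical
  let f : B → Module.Dual ℝ (B →₀ ℝ) := fun i =>
    Finsupp.linearCombination ℝ fun j => -2 * Real.cos (Real.pi / M i j)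
  have hfs : ∀ i j, f i (Finsupp.single j 1) = -2 * Real.cos (Real.pi / M i j) := fun i j => by
    simp [f, Finsupp.linearCombination_single]
  have hf : ∀ i, f i (Finsupp.single i 1) = 2 := fun i => by
    rw [hfs]; simp
  have hlift : M.IsLiftable fun i => Module.reflection (hf i) := by
    intro i j
    rcases eq_or_ne i j with rfl | hij
    · rw [M.diagonal, pow_one]
      ext1 z
      exact Module.involutive_reflection (hf i) z
    rcases Nat.eq_zero_or_pos (M i j) with h0 | h0
    · rw [h0, pow_zero]
    · have h1 := M.off_diagonal i j hij
      refine reflection_mul_reflection_pow_eq_one _ _ (by omega) (hfs i j) ?_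
      rw [hfs, M.symmetric]
  intro i j hij
  by_contra hne
  have h := congrArg (cs.lift ⟨_, hlift⟩) hij
  rw [lift_apply_simple, lift_apply_simple] at h
  have h' := congrArg (fun v : B →₀ ℝ => v i) (LinearEquiv.congr_fun h (Finsupp.single i 1))
  simp only [Module.reflection_apply, hf, Finsupp.sub_apply, Finsupp.smul_apply,
    Finsupp.single_eq_same, smul_eq_mul] at h'
  rw [Finsupp.single_eq_of_ne hne] at h'
  norm_num at h'

open scoped Classical in
/-- The permutation of `W × ZMod 2` conjugating the first component by a simple reflection and
flipping the sign exactly when the first component is that simple reflection. -/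
noncomputable def signedConj (i : B) : Equiv.Perm (W × ZMod 2) :=
  Function.Involutive.toPerm
    (fun p => (cs.simple i * p.1 * cs.simple i, p.2 + if p.1 = cs.simple i then 1 else 0)) <| by
    rintro ⟨t, ε⟩
    have h : cs.simple i * t * cs.simple i = cs.simple i ↔ t = cs.simple i := by
      rw [mul_eq_right, ← eq_inv_iff_mul_eq_one.trans Iff.rfl]
      constructor
      · intro h
        rw [← cs.inv_simple i, ← mul_eq_one_iff_eq_inv', h, inv_mul_cancel]
      · rintro rfl
        simp
    ext
    · simp [mul_assoc]
    · simp only [h]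
      rw [add_assoc, CharTwo.add_self_eq_zero, add_zero]


theorem signedConj_apply (i : B) (t : W) (ε : ZMod 2) [Decidable (t = cs.simple i)] :
    cs.signedConj i (t, ε) =
      (cs.simple i * t * cs.simple i, ε + if t = cs.simple i then 1 else 0) := by
  change (_, _) = _
  congr

open scoped Classical in
theorem signedConj_mul_pow_apply (i j : B) (k : ℕ) (t : W) (ε : ZMod 2) :
    ((cs.signedConj i * cs.signedConj j) ^ k) (t, ε) =
      ((cs.simple i * cs.simple j) ^ k * t * (cs.simple j * cs.simple i) ^ k,
        ε + ∑ n ∈ Finset.range (2 * k),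
          if t = (cs.simple j * cs.simple i) ^ n * cs.simple j then 1 else 0) := by
  have hinv : ∀ n : ℕ, ((cs.simple i * cs.simple j) ^ n)⁻¹ = (cs.simple j * cs.simple i) ^ n :=
    fun n => by rw [← inv_pow, mul_inv_rev, cs.inv_simple, cs.inv_simple]
  have hcomm : ∀ n : ℕ, cs.simple j * (cs.simple i * cs.simple j) ^ n =
      (cs.simple j * cs.simple i) ^ n * cs.simple j := fun n => by
    induction n with
    | zero => simp
    | succ n ih => rw [pow_succ, ← mul_assoc, ih, pow_succ]; simp only [mul_assoc]
  have hiff : ∀ (n : ℕ) (z : W),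
      (cs.simple i * cs.simple j) ^ n * t * (cs.simple j * cs.simple i) ^ n = z ↔
        t = (cs.simple j * cs.simple i) ^ n * z * (cs.simple i * cs.simple j) ^ n :=
    fun n z => by
      rw [← hinv n]
      constructor
      · rintro rfl; group
      · intro h; rw [h]; group
  induction k with
  | zero => simp
  | succ k ih =>
    rw [pow_succ', Equiv.Perm.mul_apply, ih, Equiv.Perm.mul_apply, signedConj_apply,
      signedConj_apply]
    have h1 : ((cs.simple i * cs.simple j) ^ k * t * (cs.simple j * cs.simple i) ^ k =
        cs.simple j) ↔ t = (cs.simple j * cs.simple i) ^ (2 * k) * cs.simple j := by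
      rw [hiff, mul_assoc, hcomm, ← mul_assoc, ← pow_add, two_mul]
    have h2 : (cs.simple j * ((cs.simple i * cs.simple j) ^ k * t *
        (cs.simple j * cs.simple i) ^ k) * cs.simple j = cs.simple i) ↔
        t = (cs.simple j * cs.simple i) ^ (2 * k + 1) * cs.simple j := by
      have : ∀ z : W, cs.simple j * z * cs.simple j = cs.simple i ↔
          z = cs.simple j * cs.simple i * cs.simple j := fun z => by
        constructor
        · intro h; rw [← h]; simp [mul_assoc]
        · rintro rfl; simp [mul_assoc]
      rw [this, hiff, mul_assoc, mul_assoc _ (cs.simple j) (_ ^ k), hcomm, ← mul_assoc,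
        ← mul_assoc, ← pow_succ, ← pow_add]
      congr! 3
      omega
    ext
    · simp only [pow_succ' (cs.simple i * cs.simple j), pow_succ (cs.simple j * cs.simple i),
        mul_assoc]
    · simp only [h1, h2]
      rw [show 2 * (k + 1) = 2 * k + 1 + 1 by ring, Finset.sum_range_succ, Finset.sum_range_succ]
      simp only [add_assoc]

theorem isLiftable_signedConj : M.IsLiftable cs.signedConj := by
  classical
  intro i j
  ext1 ⟨t, ε⟩
  rw [signedConj_mul_pow_apply, cs.simple_mul_simple_pow, cs.simple_mul_simple_pow', two_mul,
    Finset.sum_range_add]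
  simp only [pow_add, cs.simple_mul_simple_pow', one_mul, mul_one]
  rw [CharTwo.add_self_eq_zero, add_zero]
  rfl

/-- The action of `W` on `W × ZMod 2` by signed conjugation. -/
noncomputable def signedConjHom : W →* Equiv.Perm (W × ZMod 2) :=
  cs.lift ⟨cs.signedConj, cs.isLiftable_signedConj⟩

theorem signedConjHom_simple (i : B) : cs.signedConjHom (cs.simple i) = cs.signedConj i :=
  cs.lift_apply_simple cs.isLiftable_signedConj i

open scoped Classical in
theorem signedConjHom_wordProd_apply (ω : List B) (t : W) (ε : ZMod 2) :
    cs.signedConjHom (cs.wordProd ω) (t, ε) =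
      (cs.wordProd ω * t * (cs.wordProd ω)⁻¹, ε + ((cs.rightInvSeq ω).count t : ℕ)) := by
  induction ω with
  | nil => simp
  | cons i ω ih =>
    rw [wordProd_cons, map_mul, Equiv.Perm.mul_apply, ih, signedConjHom_simple, signedConj_apply]
    ext
    · simp [mul_assoc]
    · have h : (cs.wordProd ω)⁻¹ * cs.simple i * cs.wordProd ω = t ↔
          cs.wordProd ω * t * (cs.wordProd ω)⁻¹ = cs.simple i := by
        constructor
        · rintro rfl; group
        · intro h; rw [← h]; group
      simp only [rightInvSeq, List.count_cons, beq_iff_eq, h]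
      push_cast
      rw [add_assoc]

/-- The sign picked up by `t` under the action of `w`. -/
noncomputable def inversionSign (w t : W) : ZMod 2 := (cs.signedConjHom w (t, 0)).2

open scoped Classical in
theorem inversionSign_wordProd (ω : List B) (t : W) :
    cs.inversionSign (cs.wordProd ω) t = ((cs.rightInvSeq ω).count t : ℕ) := by
  rw [inversionSign, signedConjHom_wordProd_apply, zero_add]

theorem signedConjHom_apply (w t : W) (ε : ZMod 2) :
    cs.signedConjHom w (t, ε) = (w * t * w⁻¹, ε + cs.inversionSign w t) := by
  classical
  obtain ⟨ω, -, rfl⟩ := cs.exists_isReduced w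
  rw [signedConjHom_wordProd_apply, inversionSign_wordProd]

theorem inversionSign_mul (w w' t : W) :
    cs.inversionSign (w * w') t =
      cs.inversionSign w' t + cs.inversionSign w (w' * t * w'⁻¹) := by
  conv_lhs => rw [inversionSign, map_mul, Equiv.Perm.mul_apply, signedConjHom_apply,
    signedConjHom_apply, zero_add]

theorem IsReflection.inversionSign_self {t : W} (ht : cs.IsReflection t) :
    cs.inversionSign t t = 1 := by
  classical
  obtain ⟨v, i, rfl⟩ := ht
  have h1 : cs.inversionSign (v * v⁻¹) (v * cs.simple i * v⁻¹) = 0 := by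
    rw [mul_inv_cancel, inversionSign, map_one]; rfl
  rw [inversionSign_mul] at h1
  have e : v⁻¹ * (v * cs.simple i * v⁻¹) * v⁻¹⁻¹ = cs.simple i := by group
  have h2 : cs.inversionSign (cs.simple i) (cs.simple i) = 1 := by
    rw [inversionSign, signedConjHom_simple, signedConj_apply]; simp
  rw [e] at h1
  rw [inversionSign_mul, e, inversionSign_mul, h2]
  rw [mul_inv_cancel_right, add_left_comm, h1, add_zero]

/-- The strong exchange property. -/
theorem exists_eraseIdx_of_length_mul_lt {t : W} (ht : cs.IsReflection t) (ω : List B)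
    (h : cs.length (cs.wordProd ω * t) < cs.length (cs.wordProd ω)) :
    ∃ j < ω.length, cs.wordProd ω * t = cs.wordProd (ω.eraseIdx j) := by
  classical
  have hmem : t ∈ cs.rightInvSeq ω := by
    by_contra hmem
    have h0 : cs.inversionSign (cs.wordProd ω) t = 0 := by
      rw [inversionSign_wordProd, List.count_eq_zero_of_not_mem hmem, Nat.cast_zero]
    have h1 : cs.inversionSign (cs.wordProd ω * t) t = 1 := by
      rw [inversionSign_mul, ht.inversionSign_self, mul_inv_cancel_right, h0, add_zero]
    obtain ⟨ω', hω', hw⟩ := cs.exists_isReduced (cs.wordProd ω * t)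
    rw [hw, inversionSign_wordProd] at h1
    have hmem' : t ∈ cs.rightInvSeq ω' := by
      by_contra hn
      rw [List.count_eq_zero_of_not_mem hn] at h1
      exact absurd h1 (by decide)
    have := (cs.isRightInversion_of_mem_rightInvSeq hω' hmem').2
    rw [← hw, mul_assoc, ht.mul_self, mul_one] at this
    omega
  obtain ⟨j, hj, rfl⟩ := List.getElem_of_mem hmem
  refine ⟨j, by simpa using hj, ?_⟩
  rw [← wordProd_mul_getD_rightInvSeq, List.getD_eq_getElem _ _ hj]

end CoxeterSystem

section Bruhat

open CoxeterSystem

variable {B : Type*} {W : Type*} [Group W] {M : CoxeterMatrix B} {cs : CoxeterSystem M W}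

theorem bruhatLE_refl (u : W) : bruhatLE cs u u := Relation.ReflTransGen.refl

theorem bruhatLE.trans {u v w : W} (h : bruhatLE cs u v) (h' : bruhatLE cs v w) :
    bruhatLE cs u w := Relation.ReflTransGen.trans h h'

theorem bruhatLE_of_length_lt {u v t : W} (ht : cs.IsReflection t) (hv : v = u * t)
    (h : cs.length u < cs.length v) : bruhatLE cs u v :=
  Relation.ReflTransGen.single ⟨t, ht, hv, h⟩

theorem bruhatLE_simple_mul {u : W} {i : B} (h : cs.length u < cs.length (cs.simple i * u)) :
    bruhatLE cs u (cs.simple i * u) :=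
  bruhatLE_of_length_lt ((cs.isReflection_simple i).conj u⁻¹) (by group) h

theorem simple_mul_bruhatLE {u : W} {i : B} (h : cs.length (cs.simple i * u) < cs.length u) :
    bruhatLE cs (cs.simple i * u) u := by
  have := @bruhatLE_simple_mul _ _ _ _ cs (cs.simple i * u) i
  rw [cs.simple_mul_simple_cancel_left] at this
  exact this h

theorem bruhatLE.length_le {u v : W} (h : bruhatLE cs u v) : cs.length u ≤ cs.length v := by
  induction h with
  | refl => rfl
  | tail _ h ih => obtain ⟨t, -, -, h⟩ := h; omega

theorem bruhatLE.eq_of_length_le {u v : W} (h : bruhatLE cs u v)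
    (hl : cs.length v ≤ cs.length u) : u = v := by
  cases h with
  | refl => rfl
  | tail h' h =>
    obtain ⟨t, -, -, h⟩ := h
    have := bruhatLE.length_le h'
    omega

theorem bruhatLE.length_lt {u v : W} (h : bruhatLE cs u v) (hne : u ≠ v) :
    cs.length u < cs.length v :=
  lt_of_not_ge fun hl => hne (h.eq_of_length_le hl)

theorem bruhatLE.inv {u v : W} (h : bruhatLE cs u v) : bruhatLE cs u⁻¹ v⁻¹ := by
  induction h with
  | refl => exact bruhatLE_refl _
  | @tail x y _ h ih =>
    obtain ⟨t, ht, rfl, h⟩ := h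
    refine ih.trans (bruhatLE_of_length_lt (ht.conj x) ?_ (by simpa only [cs.length_inv] using h))
    rw [mul_inv_rev, ht.inv]
    group

theorem eq_or_length_lt_of_simple_mul (i : B) {u v t : W} (ht : cs.IsReflection t)
    (hv : v = u * t) (h : cs.length u < cs.length v) :
    cs.simple i * u = v ∨ cs.length (cs.simple i * u) < cs.length (cs.simple i * v) := by
  by_contra! hcon
  obtain ⟨hne, hle⟩ := hcon
  have hne' : cs.length (cs.simple i * v) ≠ cs.length (cs.simple i * u) := by
    rw [hv, ← mul_assoc]; exact ht.length_mul_left_ne _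
  obtain ⟨ω, hω, hvω⟩ := cs.exists_isReduced (cs.simple i * v)
  have hvω' : v = cs.wordProd (i :: ω) := by
    rw [cs.wordProd_cons, ← hvω, cs.simple_mul_simple_cancel_left]
  have huv : u = v * t := by rw [hv, mul_assoc, ht.mul_self, mul_one]
  obtain ⟨j, hj, hej⟩ := cs.exists_eraseIdx_of_length_mul_lt ht (i :: ω)
    (by rw [← hvω', ← huv]; exact h)
  rw [← hvω', ← huv] at hej
  cases j with
  | zero =>
    apply hne
    rw [hej, List.eraseIdx_cons_zero, ← hvω, cs.simple_mul_simple_cancel_left]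
  | succ j =>
    rw [List.eraseIdx_cons_succ, cs.wordProd_cons] at hej
    have h1 := cs.length_wordProd_le (ω.eraseIdx j)
    have h2 : cs.length (cs.simple i * v) = ω.length := by rw [hvω]; exact hω
    have h3 : j < ω.length := by simpa using hj
    rw [List.length_eraseIdx_of_lt h3] at h1
    have h4 : cs.simple i * u = cs.wordProd (ω.eraseIdx j) := by
      rw [hej, cs.simple_mul_simple_cancel_left]
    rw [← h4] at h1
    omega

theorem bruhatLE.simple_mul_or (i : B) {u v : W} (h : bruhatLE cs u v) :
    bruhatLE cs (cs.simple i * u) v ∨ bruhatLE cs (cs.simple i * u) (cs.simple i * v) := by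
  induction h using Relation.ReflTransGen.head_induction_on with
  | refl => exact Or.inr (bruhatLE_refl _)
  | head h h' ih =>
    obtain ⟨t, ht, hv, hl⟩ := h
    rcases eq_or_length_lt_of_simple_mul i ht hv hl with h1 | h1
    · rw [h1]; exact Or.inl h'
    · have := bruhatLE_of_length_lt ht (by rw [hv, mul_assoc]) h1
      exact ih.imp this.trans this.trans

theorem bruhatLE.or_simple_mul (i : B) {u v : W} (h : bruhatLE cs u v) :
    bruhatLE cs u (cs.simple i * v) ∨ bruhatLE cs (cs.simple i * u) (cs.simple i * v) := by
  induction h with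
  | refl => exact Or.inr (bruhatLE_refl _)
  | tail h' h ih =>
    obtain ⟨t, ht, hv, hl⟩ := h
    rcases eq_or_length_lt_of_simple_mul i ht hv hl with h1 | h1
    · rw [← h1, cs.simple_mul_simple_cancel_left]; exact Or.inl h'
    · have := bruhatLE_of_length_lt ht (by rw [hv, mul_assoc]) h1
      exact ih.imp (·.trans this) (·.trans this)

theorem bruhatLE.simple_mul_left {i : B} {u v : W} (h : bruhatLE cs u v)
    (hv : cs.length (cs.simple i * v) < cs.length v) : bruhatLE cs (cs.simple i * u) v :=
  (h.simple_mul_or i).elim id fun h' => h'.trans (simple_mul_bruhatLE hv)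

theorem bruhatLE.simple_mul_simple_mul {i : B} {u v : W} (h : bruhatLE cs u v)
    (hv : cs.length v < cs.length (cs.simple i * v)) :
    bruhatLE cs (cs.simple i * u) (cs.simple i * v) :=
  (h.simple_mul_or i).elim (fun h' => h'.trans (bruhatLE_simple_mul hv)) id

theorem bruhatLE.simple_mul_right {i : B} {u v : W} (h : bruhatLE cs u v)
    (hu : cs.length u < cs.length (cs.simple i * u)) : bruhatLE cs u (cs.simple i * v) :=
  (h.or_simple_mul i).elim id fun h' => (bruhatLE_simple_mul hu).trans h'

theorem exists_bruhatLE_length_add_one {u v : W} (h : bruhatLE cs u v) (hne : u ≠ v) :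
    ∃ z, bruhatLE cs u z ∧ bruhatLE cs z v ∧ cs.length v = cs.length z + 1 := by
  induction hn : cs.length v generalizing u v with
  | zero => have := h.length_lt hne; omega
  | succ n ih =>
    have hv1 : v ≠ 1 := by rintro rfl; simp at hn
    obtain ⟨i, hi⟩ := cs.exists_leftDescent_of_ne_one hv1
    have hi' := cs.isLeftDescent_iff.1 hi
    rcases cs.length_simple_mul u i with hu | hu
    · exact ⟨cs.simple i * v, h.simple_mul_right (by omega), simple_mul_bruhatLE hi, by omega⟩
    · have h1 : bruhatLE cs (cs.simple i * u) (cs.simple i * v) :=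
        ((simple_mul_bruhatLE (by omega)).trans h).simple_mul_right
          (by rw [cs.simple_mul_simple_cancel_left]; omega)
      obtain ⟨z, hz1, hz2, hz3⟩ := ih h1 (fun h => hne (mul_left_cancel h)) (by omega)
      rcases cs.length_simple_mul z i with hz | hz
      · refine ⟨cs.simple i * z, ?_, ?_, by omega⟩
        · have := hz1.simple_mul_simple_mul (i := i) (by omega)
          rwa [cs.simple_mul_simple_cancel_left] at this
        · exact (hz2.trans (simple_mul_bruhatLE hi)).simple_mul_left hi
      · refine ⟨cs.simple i * v, ?_, simple_mul_bruhatLE hi, by omega⟩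
        have := hz1.simple_mul_left (i := i) (by omega)
        rw [cs.simple_mul_simple_cancel_left] at this
        exact this.trans hz2

theorem bCov_iff {u v : W} :
    bCov cs u v ↔ bruhatLE cs u v ∧ cs.length v = cs.length u + 1 := by
  constructor
  · rintro ⟨h, hne, hz⟩
    obtain ⟨z, hz1, hz2, hz3⟩ := exists_bruhatLE_length_add_one h hne
    rcases hz z hz1 hz2 with rfl | rfl
    · exact ⟨h, hz3⟩
    · omega
  · rintro ⟨h, hl⟩
    refine ⟨h, by rintro rfl; omega, fun z hz1 hz2 => ?_⟩
    by_cases hzu : u = z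
    · exact Or.inl hzu.symm
    · have := hz1.length_lt hzu
      exact Or.inr (hz2.eq_of_length_le (by omega))

theorem bCov.le {u v : W} (h : bCov cs u v) : bruhatLE cs u v := h.1

theorem bCov.length_eq {u v : W} (h : bCov cs u v) : cs.length v = cs.length u + 1 :=
  (bCov_iff.1 h).2

theorem exists_bCov_of_ne {u v : W} (h : bruhatLE cs u v) (hne : u ≠ v) :
    ∃ z, bruhatLE cs u z ∧ bCov cs z v := by
  obtain ⟨z, h1, h2, h3⟩ := exists_bruhatLE_length_add_one h hne
  exact ⟨z, h1, bCov_iff.2 ⟨h2, h3⟩⟩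

theorem bCov_simple_mul_left {i : B} {v : W}
    (h : cs.length v = cs.length (cs.simple i * v) + 1) : bCov cs (cs.simple i * v) v :=
  bCov_iff.2 ⟨simple_mul_bruhatLE (by omega), h⟩

theorem bCov_simple_mul_right {i : B} {v : W}
    (h : cs.length (cs.simple i * v) = cs.length v + 1) : bCov cs v (cs.simple i * v) :=
  bCov_iff.2 ⟨bruhatLE_simple_mul (by omega), h⟩

theorem bCov.inv {u v : W} (h : bCov cs u v) : bCov cs u⁻¹ v⁻¹ :=
  bCov_iff.2 ⟨h.le.inv, by simpa only [cs.length_inv] using h.length_eq⟩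

theorem bCov.isLeftDescent {i : B} {c y : W} (h : bCov cs c y) (hy : cs.IsLeftDescent y i)
    (hne : c ≠ cs.simple i * y) : cs.IsLeftDescent c i := by
  by_contra hc
  have h1 := cs.not_isLeftDescent_iff.1 hc
  have h2 := cs.isLeftDescent_iff.1 hy
  have h3 := h.length_eq
  exact hne ((h.le.simple_mul_right (by omega)).eq_of_length_le (by omega))

/-- The coatoms of `s z`, when `s z` is longer than `z`. -/
theorem bCov_simple_mul_iff {i : B} {c z : W}
    (hz : cs.length (cs.simple i * z) = cs.length z + 1) :
    bCov cs c (cs.simple i * z) ↔ c = z ∨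
      ∃ v, bCov cs v z ∧ cs.length (cs.simple i * v) = cs.length v + 1 ∧
        c = cs.simple i * v := by
  constructor
  · intro h
    by_cases hc : c = z
    · exact Or.inl hc
    · have hd := cs.isLeftDescent_iff.1 <| h.isLeftDescent (i := i)
        (cs.isLeftDescent_iff.2 (by rw [cs.simple_mul_simple_cancel_left]; omega))
        (by rwa [cs.simple_mul_simple_cancel_left])
      have hl := h.length_eq
      refine Or.inr ⟨cs.simple i * c, bCov_iff.2 ⟨?_, by omega⟩, ?_, ?_⟩
      · have := ((simple_mul_bruhatLE (by omega)).trans h.le).simple_mul_right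
          (i := i) (u := cs.simple i * c) (by rw [cs.simple_mul_simple_cancel_left]; omega)
        rwa [cs.simple_mul_simple_cancel_left] at this
      · rw [cs.simple_mul_simple_cancel_left]; omega
      · rw [cs.simple_mul_simple_cancel_left]
  · rintro (rfl | ⟨v, hv, hl, rfl⟩)
    · exact bCov_simple_mul_right hz
    · have := hv.length_eq
      exact bCov_iff.2 ⟨hv.le.simple_mul_simple_mul (by omega), by omega⟩

theorem bCov.exists_eraseIdx {c : W} {ω : List B} (h : bCov cs c (cs.wordProd ω)) :
    ∃ j < ω.length, c = cs.wordProd (ω.eraseIdx j) := by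
  have hl := h.length_eq
  obtain ⟨t, ht, hv⟩ : ∃ t, cs.IsReflection t ∧ cs.wordProd ω = c * t := by
    rcases Relation.ReflTransGen.cases_tail h.le with h' | ⟨x, hx, t, ht, hv, hlt⟩
    · rw [h'] at hl; omega
    · obtain rfl : c = x := bruhatLE.eq_of_length_le hx (by omega)
      exact ⟨t, ht, hv⟩
  have hc : cs.wordProd ω * t = c := by rw [hv, mul_assoc, ht.mul_self, mul_one]
  rw [← hc]
  exact cs.exists_eraseIdx_of_length_mul_lt ht ω (by rw [hc]; omega)

theorem bruhatLE.exists_sublist {u v : W} (h : bruhatLE cs u v) {ω : List B}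
    (hv : v = cs.wordProd ω) : ∃ ω' : List B, ω'.Sublist ω ∧ u = cs.wordProd ω' := by
  induction h using Relation.ReflTransGen.head_induction_on with
  | refl => exact ⟨ω, List.Sublist.refl _, hv⟩
  | head h _ ih =>
    obtain ⟨ω', hs, rfl⟩ := ih
    obtain ⟨t, ht, he, hl⟩ := h
    have hx := congrArg (· * t) he
    simp only [mul_assoc, ht.mul_self, mul_one] at hx
    obtain ⟨j, -, hj⟩ := cs.exists_eraseIdx_of_length_mul_lt ht ω' (by rw [hx]; exact hl)
    exact ⟨_, (List.eraseIdx_sublist ω' j).trans hs, by rw [← hj, hx]⟩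

theorem mem_of_simple_bruhatLE_wordProd {a : B} {ω : List B}
    (h : bruhatLE cs (cs.simple a) (cs.wordProd ω)) : a ∈ ω := by
  induction ω with
  | nil => have := h.length_le; simp at this
  | cons i ω ih =>
    by_cases hai : a = i
    · simp [hai]
    refine List.mem_cons_of_mem _ (ih ?_)
    rw [cs.wordProd_cons] at h
    rcases cs.length_simple_mul (cs.wordProd ω) i with hl | hl
    · have := h.simple_mul_right (i := i) (by
        rcases cs.length_simple_mul (cs.simple a) i with h' | h'
        · omega
        · rw [cs.length_simple] at h'
          have h1 := cs.length_eq_zero_iff.1 (Nat.succ_injective h')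
          rw [mul_eq_one_iff_inv_eq, cs.inv_simple] at h1
          exact absurd (cs.simple_injective h1).symm hai)
      rwa [cs.simple_mul_simple_cancel_left] at this
    · exact h.trans (simple_mul_bruhatLE (by omega))

end Bruhat

section Coatoms

open CoxeterSystem

variable {B : Type*} {W : Type*} [Group W] {M : CoxeterMatrix B} {cs : CoxeterSystem M W}

theorem length_altW (i j : B) (n : ℕ) : (altW i j n).length = n := by
  induction n generalizing i j with
  | zero => rfl
  | succ n ih => rw [altW, List.length_cons, ih]

theorem eq_or_eq_of_mem_altW {i j k : B} {n : ℕ} (h : k ∈ altW i j n) : k = i ∨ k = j := by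
  induction n generalizing i j with
  | zero => simp [altW] at h
  | succ n ih =>
    rw [altW, List.mem_cons] at h
    exact h.elim Or.inl fun h => (ih h).symm

/-- Elements with the same coatoms and a common right descent are equal. -/
theorem eq_of_bCoat_subset_of_isRightDescent {x y : W} {i : B}
    (hc : bCoat cs x ⊆ bCoat cs y) (hx : cs.IsRightDescent x i) (hy : cs.IsRightDescent y i) :
    x = y := by
  have h1 : bCov cs (x * cs.simple i) x := by
    have h := cs.isRightDescent_iff.1 hx
    refine bCov_iff.2 ⟨bruhatLE_of_length_lt (cs.isReflection_simple i) ?_ hx, h.symm⟩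
    rw [cs.simple_mul_simple_cancel_right]
  have h2 : bCov cs (x * cs.simple i) y := hc h1
  by_contra hne
  have h3 := h2.inv.isLeftDescent (cs.isLeftDescent_inv_iff.2 hy) fun h => hne <| by
    rw [mul_inv_rev, cs.inv_simple] at h
    exact inv_injective (mul_left_cancel h)
  rw [cs.isLeftDescent_inv_iff] at h3
  have h4 : cs.length (x * cs.simple i * cs.simple i) < _ := h3
  rw [cs.simple_mul_simple_cancel_right] at h4
  exact absurd hx (by unfold IsRightDescent; omega)

theorem CoxeterSystem.IsReduced.isRightDescent_concat {ω : List B} {i : B}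
    (h : cs.IsReduced (ω ++ [i])) : cs.IsRightDescent (cs.wordProd (ω ++ [i])) i := by
  unfold IsRightDescent
  have h1 := cs.length_wordProd_le ω
  rw [h.eq, cs.wordProd_append, cs.wordProd_singleton, cs.simple_mul_simple_cancel_right]
  simp only [List.length_append, List.length_singleton]
  omega

/-- If `x` and `y` share their coatoms but no right descent, then a reduced prefix `α` of `y`
lengthens to a reduced prefix `r α` of `x`, for any left descent `r` of `x`. -/
theorem exists_eq_wordProd_cons {x y : W} {r : B} {α ω : List B}
    (hc : bCoat cs x ⊆ bCoat cs y) (hl : cs.length x = cs.length y)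
    (hno : ∀ i, cs.IsRightDescent x i → ¬ cs.IsRightDescent y i)
    (hr : cs.IsLeftDescent x r) (hy : y = cs.wordProd (α ++ ω)) (hred : cs.IsReduced (α ++ ω))
    (hω : ω ≠ []) :
    ∃ ω', x = cs.wordProd (r :: α ++ ω') ∧ ω'.length + 1 = ω.length := by
  have h1 : bCov cs (cs.simple r * x) x :=
    bCov_simple_mul_left (cs.isLeftDescent_iff.1 hr).symm
  have h2 : bCov cs (cs.simple r * x) y := hc h1
  rw [hy] at h2
  obtain ⟨j, hj, hu⟩ := h2.exists_eraseIdx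
  have hx : x = cs.wordProd (r :: (α ++ ω).eraseIdx j) := by
    rw [cs.wordProd_cons, ← hu, cs.simple_mul_simple_cancel_left]
  have hlen : cs.length y = (α ++ ω).length := by rw [hy]; exact hred
  rcases lt_or_ge j α.length with hjα | hjα
  · exfalso
    rw [List.eraseIdx_append_of_lt_length hjα] at hx
    have he : (α.eraseIdx j).length + 1 = α.length := by
      rw [List.length_eraseIdx_of_lt hjα]; omega
    obtain ⟨ω', i, rfl⟩ := List.eq_nil_or_concat ω |>.resolve_left hω
    rw [List.concat_eq_append, ← List.append_assoc] at hy hred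
    rw [List.concat_eq_append, ← List.append_assoc, ← List.cons_append] at hx
    refine hno i ?_ (hy ▸ hred.isRightDescent_concat)
    rw [hx]
    refine CoxeterSystem.IsReduced.isRightDescent_concat ?_
    unfold CoxeterSystem.IsReduced
    rw [← hx, hl, hlen]
    simp only [List.concat_eq_append, List.length_append, List.length_cons, List.length_nil]
    omega
  · rw [List.eraseIdx_append_of_length_le hjα] at hx
    have hj' : j - α.length < ω.length := by
      rw [List.length_append] at hj; omega
    refine ⟨_, hx, ?_⟩
    rw [List.length_eraseIdx_of_lt hj']
    omega

/-- Distinct elements with the same coatoms and no common right descent lie in the standard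
dihedral subgroup generated by any of their left descents. -/
theorem eq_wordProd_altW_of_bCoat_eq {x y : W} {r s : B}
    (hc : bCoat cs x = bCoat cs y) (hl : cs.length x = cs.length y)
    (hno : ∀ i, cs.IsRightDescent x i → ¬ cs.IsRightDescent y i)
    (hr : cs.IsLeftDescent x r) (hs : cs.IsLeftDescent y s) :
    y = cs.wordProd (altW s r (cs.length y)) := by
  have key : ∀ k, k < cs.length y →
      (∃ ω, x = cs.wordProd (altW r s (k + 1) ++ ω) ∧ ω.length + (k + 1) = cs.length y) ∧
      (∃ ω, y = cs.wordProd (altW s r (k + 1) ++ ω) ∧ ω.length + (k + 1) = cs.length y) := by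
    intro k
    induction k with
    | zero =>
      intro _
      have aux : ∀ (z : W) (i : B), cs.IsLeftDescent z i →
          ∃ ω, z = cs.wordProd (i :: ω) ∧ ω.length + 1 = cs.length z := fun z i hi => by
        obtain ⟨ω, hω, he⟩ := cs.exists_isReduced (cs.simple i * z)
        refine ⟨ω, ?_, ?_⟩
        · rw [cs.wordProd_cons, ← he, cs.simple_mul_simple_cancel_left]
        · rw [← hω.eq, ← he, cs.isLeftDescent_iff.1 hi]
      exact ⟨hl ▸ aux x r hr, aux y s hs⟩
    | succ k ih =>
      intro hk
      obtain ⟨⟨ω, hx, hωx⟩, ω', hy, hωy⟩ := ih (by omega)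
      have hredx : cs.IsReduced (altW r s (k + 1) ++ ω) := by
        unfold CoxeterSystem.IsReduced
        rw [← hx, hl, List.length_append, length_altW]; omega
      have hredy : cs.IsReduced (altW s r (k + 1) ++ ω') := by
        unfold CoxeterSystem.IsReduced
        rw [← hy, List.length_append, length_altW]; omega
      obtain ⟨ρ, h1, h2⟩ := exists_eq_wordProd_cons hc.subset hl hno hr hy hredy
        (by rintro rfl; simp at hωy; omega)
      obtain ⟨ρ', h1', h2'⟩ := exists_eq_wordProd_cons hc.symm.subset hl.symm
        (fun i hi hi' => hno i hi' hi) hs hx hredx (by rintro rfl; simp at hωx; omega)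
      exact ⟨⟨ρ, h1, by omega⟩, ρ', h1', by omega⟩
  have hpos : 0 < cs.length y := by
    have := cs.isLeftDescent_iff.1 hs; omega
  obtain ⟨-, ω, hy, hω⟩ := key (cs.length y - 1) (by omega)
  have h0 : ω = [] := List.length_eq_zero_iff.1 (by omega)
  rw [h0, List.append_nil, Nat.sub_add_cancel hpos] at hy
  exact hy

end Coatoms

section Matching

open CoxeterSystem

variable {B : Type*} {W : Type*} [Group W] {M : CoxeterMatrix B} {cs : CoxeterSystem M W}

theorem BSM.simple_bruhatLE (φ : BSM cs) {a : B}
    (ha : φ.toFun 1 = cs.simple a) {w : W} (hw : w ∈ φ.dom) (hup : bCov cs w (φ.toFun w)) :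
    bruhatLE cs (cs.simple a) (φ.toFun w) := by
  induction hn : cs.length w using Nat.strong_induction_on generalizing w with
  | _ n ih =>
    by_cases hw1 : w = 1
    · rw [hw1, ha]; exact bruhatLE_refl _
    · obtain ⟨i, hi⟩ := cs.exists_leftDescent_of_ne_one hw1
      have hvw := bCov_simple_mul_left (cs.isLeftDescent_iff.1 hi).symm
      have hl := hvw.length_eq
      have hv := φ.ideal hw hvw.le
      rcases φ.cov _ hv with h | h
      · have hlt := h.length_eq
        have hu := φ.maps _ hv
        have := ih _ (by omega) hu (by rw [φ.invol _ hv]; exact h) rfl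
        rw [φ.invol _ hv] at this
        exact (this.trans hvw.le).trans hup.le
      · have h2 : φ.toFun (cs.simple i * w) ∈ bCoat cs (φ.toFun w) := by
          rw [φ.coatom w hw hup]
          exact Or.inr ⟨_, hvw, h, rfl⟩
        exact (ih _ (by omega) hv h rfl).trans h2.le

/-- If the coatoms of `x` lie in the domain of a maximal partial special matching `φ`, and those
of `y` are the ones prescribed by matching `x` with `y`, then `x` lies in the domain. -/
theorem BMax.mem_dom {φ : BSM cs} (hmax : BMax φ) {x y : W} (hxy : bCov cs x y)
    (hxc : bCoat cs x ⊆ φ.dom)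
    (hyc : bCoat cs y =
      {x} ∪ {z | ∃ c, bCov cs c x ∧ bCov cs c (φ.toFun c) ∧ z = φ.toFun c}) : x ∈ φ.dom := by
  classical
  by_contra hx
  have hy : y ∉ φ.dom := fun hy => hx (φ.ideal hy hxy.le)
  have hne : y ≠ x := hxy.2.1.symm
  have hdx : ∀ u ∈ φ.dom, u ≠ x := fun u hu h => hx (h ▸ hu)
  have hdy : ∀ u ∈ φ.dom, u ≠ y := fun u hu h => hy (h ▸ hu)
  let f : W → W := fun z => if z = x then y else if z = y then x else φ.toFun z
  have fx : f x = y := if_pos rfl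
  have fy : f y = x := by simp only [f, if_neg hne, if_true]
  have fd : ∀ u ∈ φ.dom, f u = φ.toFun u := fun u hu => by
    simp only [f, if_neg (hdx u hu), if_neg (hdy u hu)]
  have hyd : ∀ c, bCov cs c y → c = x ∨ c ∈ φ.dom := fun c hc => by
    have hc' : c ∈ bCoat cs y := hc
    rw [hyc] at hc'
    rcases hc' with hc' | ⟨d, hd, -, rfl⟩
    · exact Or.inl hc'
    · exact Or.inr (φ.maps _ (hxc hd))
  have hix : ∀ z, bruhatLE cs z x → z = x ∨ z ∈ φ.dom := fun z hz => by
    by_cases hzx : z = x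
    · exact Or.inl hzx
    · obtain ⟨c, h1, h2⟩ := exists_bCov_of_ne hz hzx
      exact Or.inr (φ.ideal (hxc h2) h1)
  have hiy : ∀ z, bruhatLE cs z y → z = y ∨ z = x ∨ z ∈ φ.dom := fun z hz => by
    by_cases hzy : z = y
    · exact Or.inl hzy
    · obtain ⟨c, h1, h2⟩ := exists_bCov_of_ne hz hzy
      rcases hyd c h2 with rfl | h
      · exact Or.inr (hix z h1)
      · exact Or.inr (Or.inr (φ.ideal h h1))
  let ψ : BSM cs :=
    { dom := {u | u = y ∨ u = x ∨ u ∈ φ.dom}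
      toFun := f
      ideal := by
        rintro z u (rfl | rfl | hu) hz
        · exact hiy z hz
        · exact Or.inr (hix z hz)
        · exact Or.inr (Or.inr (φ.ideal hu hz))
      maps := by
        rintro u (rfl | rfl | hu)
        · rw [fy]; exact Or.inr (Or.inl rfl)
        · rw [fx]; exact Or.inl rfl
        · rw [fd u hu]; exact Or.inr (Or.inr (φ.maps u hu))
      invol := by
        rintro u (rfl | rfl | hu)
        · rw [fy, fx]
        · rw [fx, fy]
        · rw [fd u hu, fd _ (φ.maps u hu), φ.invol u hu]
      cov := by
        rintro u (rfl | rfl | hu)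
        · rw [fy]; exact Or.inl hxy
        · rw [fx]; exact Or.inr hxy
        · rw [fd u hu]; exact φ.cov u hu
      coatom := by
        rintro u hu hup
        have key : ∀ u : W, (∀ c, bCov cs c u → c ∈ φ.dom) →
            {w | ∃ v, bCov cs v u ∧ bCov cs v (f v) ∧ w = f v} =
              {w | ∃ v, bCov cs v u ∧ bCov cs v (φ.toFun v) ∧ w = φ.toFun v} :=
          fun u hu => by
            ext w
            refine exists_congr fun v => and_congr_right fun hv => ?_
            rw [fd v (hu v hv)]
        rcases hu with rfl | rfl | hu
        · rw [fy] at hup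
          have h1 := hup.length_eq
          have h2 := hxy.length_eq
          omega
        · rw [fx, hyc, key _ fun c hc => hxc hc]
        · rw [fd u hu] at hup ⊢
          rw [key _ fun c hc => φ.ideal hu hc.le]
          exact φ.coatom u hu hup }
  have hψ : ψ.dom = φ.dom := hmax ψ ⟨fun u hu => Or.inr (Or.inr hu), fd⟩
  exact hx (hψ ▸ (Or.inr (Or.inl rfl) : x ∈ ψ.dom))

end Matching

/-- local-to-global commutation criterion: if `φ` commutes with left
multiplication by `s` on `P_s ∩ [e,w]`, then `sw` is in the domain and
`φ(sw) = s φ(w)`. -/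
theorem stmt10 {B : Type*} {W : Type*} [Group W] {M : CoxeterMatrix B}
    (cs : CoxeterSystem M W) (φ : BSM cs) (hmax : BMax φ)
    (h1 : (1 : W) ∈ φ.dom) (a : B) (ha : φ.toFun 1 = cs.simple a)
    (s : B) (hs : s ≠ a) (w : W) (hw : w ∈ φ.dom)
    (hcomm : ∀ v : W, bruhatLE cs v w → v ∈ dihedral cs s a →
      cs.simple s * v ∈ φ.dom ∧
      φ.toFun (cs.simple s * v) = cs.simple s * φ.toFun v) :
    cs.simple s * w ∈ φ.dom ∧
      φ.toFun (cs.simple s * w) = cs.simple s * φ.toFun w := by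
  induction hn : cs.length w using Nat.strong_induction_on generalizing w with
  | _ n ih =>
  have IH : ∀ v, bruhatLE cs v w → v ≠ w → cs.simple s * v ∈ φ.dom ∧
      φ.toFun (cs.simple s * v) = cs.simple s * φ.toFun v := fun v hv hne =>
    ih _ (hn ▸ hv.length_lt hne) v (φ.ideal hw hv) (fun u hu => hcomm u (hu.trans hv)) rfl
  have cancel : ∀ z : W, cs.simple s * (cs.simple s * z) = z :=
    fun z => cs.simple_mul_simple_cancel_left s
  by_cases hwP : w ∈ dihedral cs s a
  · exact hcomm w (bruhatLE_refl w) hwP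
  rcases (cs.length_simple_mul w s).symm with hsw | hsw
  · have hle := bCov_simple_mul_left hsw.symm
    obtain ⟨-, h⟩ := IH _ hle.le hle.2.1
    rw [cancel] at h
    exact ⟨φ.ideal hw hle.le, by rw [h, cancel]⟩
  rcases φ.cov w hw with hup | hup
  · obtain ⟨h, h'⟩ := IH _ hup.le hup.2.1
    rw [φ.invol w hw] at h'
    exact ⟨h' ▸ φ.maps _ h, by rw [← h', φ.invol _ h]⟩
  have hwl := hup.length_eq
  by_cases hφs : φ.toFun w = cs.simple s * w
  · exact ⟨hφs ▸ φ.maps w hw, by rw [← hφs, φ.invol w hw, hφs, cancel]⟩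
  have hcoat := φ.coatom w hw hup
  have hy : cs.length (cs.simple s * φ.toFun w) = cs.length (φ.toFun w) + 1 := by
    refine (cs.length_simple_mul _ s).resolve_right fun h => ?_
    have h2 : cs.simple s * φ.toFun w ∈ bCoat cs (φ.toFun w) := bCov_simple_mul_left h.symm
    rw [hcoat] at h2
    rcases h2 with h2 | ⟨v, hv, -, he⟩
    · exact hφs (by rw [← cancel (φ.toFun w), Set.mem_singleton_iff.1 h2])
    · obtain ⟨hd, h3⟩ := IH v hv.le hv.2.1
      rw [← he, cancel] at h3
      have h4 : cs.simple s * v = w := by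
        rw [← φ.invol _ hd, h3, φ.invol w hw]
      have h5 := hv.length_eq
      have h6 : cs.simple s * w = v := by rw [← h4, cancel]
      rw [h6] at hsw
      omega
  have hxy : bCov cs (cs.simple s * w) (cs.simple s * φ.toFun w) :=
    bCov_iff.2 ⟨hup.le.simple_mul_simple_mul (by omega), by omega⟩
  have hxc : bCoat cs (cs.simple s * w) ⊆ φ.dom := fun c hc => by
    rcases (bCov_simple_mul_iff hsw).1 hc with rfl | ⟨v, hv, -, rfl⟩
    · exact hw
    · exact (IH v hv.le hv.2.1).1
  have hyc : bCoat cs (cs.simple s * φ.toFun w) = {cs.simple s * w} ∪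
      {z | ∃ c, bCov cs c (cs.simple s * w) ∧ bCov cs c (φ.toFun c) ∧ z = φ.toFun c} := by
    ext c
    rw [Set.mem_union, Set.mem_singleton_iff]
    constructor
    · intro hc
      rcases (bCov_simple_mul_iff hy).1 hc with rfl | ⟨u, hu, hul, rfl⟩
      · exact Or.inr ⟨w, bCov_simple_mul_right hsw, hup, rfl⟩
      · have hu' : u ∈ bCoat cs (φ.toFun w) := hu
        rw [hcoat] at hu'
        rcases hu' with hu' | ⟨v, hv, hvu, rfl⟩
        · exact Or.inl (by rw [Set.mem_singleton_iff.1 hu'])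
        · obtain ⟨hd, he⟩ := IH v hv.le hv.2.1
          have h3 := hvu.length_eq
          rcases φ.cov _ hd with h | h
          · have h4 := h.length_eq
            rw [he] at h4
            have := cs.length_simple_mul v s
            omega
          · have h4 := h.length_eq
            rw [he] at h4
            refine Or.inr ⟨_, (bCov_simple_mul_iff hsw).2 (Or.inr ⟨v, hv, by omega, rfl⟩), h,
              he.symm⟩
    · rintro (rfl | ⟨d, hd, hdu, rfl⟩)
      · exact hxy
      · rcases (bCov_simple_mul_iff hsw).1 hd with rfl | ⟨v, hv, hvl, rfl⟩
        · exact bCov_simple_mul_right hy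
        · obtain ⟨-, he⟩ := IH v hv.le hv.2.1
          have h3 := hdu.length_eq
          rw [he] at h3 ⊢
          have h4 := cs.length_simple_mul (φ.toFun v) s
          have hvd := φ.ideal hw hv.le
          have hvu : bCov cs v (φ.toFun v) := (φ.cov v hvd).resolve_left fun h => by
            have := h.length_eq
            omega
          have h5 := hvu.length_eq
          refine (bCov_simple_mul_iff hy).2 (Or.inr ⟨_, ?_, by omega, rfl⟩)
          change _ ∈ bCoat cs (φ.toFun w)
          rw [hcoat]
          exact Or.inr ⟨v, hv, hvu, rfl⟩
  have hxd : cs.simple s * w ∈ φ.dom := hmax.mem_dom hxy hxc hyc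
  refine ⟨hxd, ?_⟩
  have hxup : bCov cs (cs.simple s * w) (φ.toFun (cs.simple s * w)) := by
    refine (φ.cov _ hxd).resolve_left fun h => ?_
    rcases (bCov_simple_mul_iff hsw).1 h with h2 | ⟨v, hv, -, h2⟩
    · exact hφs (by rw [← φ.invol _ hxd, h2])
    · obtain ⟨-, h3⟩ := IH v hv.le hv.2.1
      rw [← h2, φ.invol _ hxd] at h3
      have h4 := mul_left_cancel h3
      rw [h4, φ.invol v (φ.ideal hw hv.le)] at hwl
      have := hv.length_eq
      rw [h4] at this
      omega
  have hxcoat := φ.coatom _ hxd hxup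
  rw [← hyc] at hxcoat
  have hl : cs.length (φ.toFun (cs.simple s * w)) = cs.length (cs.simple s * φ.toFun w) := by
    rw [hxup.length_eq, hxy.length_eq]
  by_contra hne
  have hx1 : φ.toFun (cs.simple s * w) ≠ 1 := fun h => by
    have := hxup.length_eq
    rw [h, cs.length_one] at this
    omega
  obtain ⟨r, hr⟩ := cs.exists_leftDescent_of_ne_one hx1
  have hword := eq_wordProd_altW_of_bCoat_eq hxcoat hl
    (fun i hi hi' => hne (eq_of_bCoat_subset_of_isRightDescent hxcoat.subset hi hi')) hr
    (cs.isLeftDescent_iff.2 (by rw [cancel]; exact hy.symm) :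
      cs.IsLeftDescent (cs.simple s * φ.toFun w) s)
  have hφy := bCov_simple_mul_right hy
  have hay := (φ.simple_bruhatLE ha hw hup).trans hφy.le
  rw [hword] at hay
  obtain rfl : a = r :=
    (eq_or_eq_of_mem_altW (mem_of_simple_bruhatLE_wordProd hay)).resolve_left (Ne.symm hs)
  obtain ⟨ω, hω, rfl⟩ := (hup.le.trans hφy.le).exists_sublist hword
  refine hwP (Subgroup.list_prod_mem _ fun z hz => ?_)
  obtain ⟨i, hi, rfl⟩ := List.mem_map.1 hz
  refine Subgroup.subset_closure ?_
  rcases eq_or_eq_of_mem_altW (hω.subset hi) with rfl | rfl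
  · exact Or.inl rfl
  · exact Or.inr rfl
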